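/- Let M be a hypermap, x a dart with a 0-successor y = α₀(x), and let M₀ be the hypermap obtained from M by breaking the 0-link at x (removing the latest 0-link at x). Then M is planar if and only if M₀ is planar and either x and y lie in distinct components of M₀, or α₁⁻¹(x) and y lie in the same face of M₀. -/

import Mathlib

open scoped Classical

/-- Dimensions 0 and 1. -/
inductive Dim : Type
  | zero : Dim
  | one : Dim
deriving DecidableEq

/-- Free maps: empty map, dart insertion, dart linking at a dimension. -/
inductive Fmap : Type
  | V : Fmap
  | I : Fmap → Nat → Fmap
  | L : Fmap → Dim → Nat → Nat → Fmap

namespace Fmap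

/-- The nil (exception) dart. -/
def nil : Nat := 0

/-- A dart exists in the map. -/
def exd : Fmap → Nat → Prop
  | V, _ => False
  | I m0 x, z => z = x ∨ exd m0 z
  | L m0 _ _ _, z => exd m0 z

/-- The (partial) k-successor α_k, with nil for undefined. -/
def A : Fmap → Dim → Nat → Nat
  | V, _, _ => nil
  | I m0 _, k, z => A m0 k z
  | L m0 k0 x y, k, z =>
      if k = k0 then (if z = x then y else A m0 k z) else A m0 k z

/-- The (partial) k-predecessor. -/
def A_1 : Fmap → Dim → Nat → Nat
  | V, _, _ => nil
  | I m0 _, k, z => A_1 m0 k z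
  | L m0 k0 x y, k, z =>
      if k = k0 then (if z = y then x else A_1 m0 k z) else A_1 m0 k z

/-- z has a k-successor. -/
def succd (m : Fmap) (k : Dim) (z : Nat) : Prop := A m k z ≠ nil

/-- z has a k-predecessor. -/
def predd (m : Fmap) (k : Dim) (z : Nat) : Prop := A_1 m k z ≠ nil

/-- Bottom dart of the open k-orbit of z. -/
def bottom : Fmap → Dim → Nat → Nat
  | V, _, _ => nil
  | I m0 x, k, z => if z = x then z else bottom m0 k z
  | L m0 k0 x y, k, z =>
      if k = k0 then
        (if bottom m0 k z = y then bottom m0 k x else bottom m0 k z)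
      else bottom m0 k z

/-- Top dart of the open k-orbit of z. -/
def top : Fmap → Dim → Nat → Nat
  | V, _, _ => nil
  | I m0 x, k, z => if z = x then z else top m0 k z
  | L m0 k0 x y, k, z =>
      if k = k0 then
        (if top m0 k z = x then top m0 k y else top m0 k z)
      else top m0 k z

/-- Closure of A: a permutation of existing darts. -/
def cA : Fmap → Dim → Nat → Nat
  | V, _, _ => nil
  | I m0 x, k, z => if z = x then z else cA m0 k z
  | L m0 k0 x y, k, z =>
      if k = k0 then
        (if z = x then y
         else if z = top m0 k y then bottom m0 k x
         else cA m0 k z)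
      else cA m0 k z

/-- Closure of A_1: the inverse permutation of cA. -/
def cA_1 : Fmap → Dim → Nat → Nat
  | V, _, _ => nil
  | I m0 x, k, z => if z = x then z else cA_1 m0 k z
  | L m0 k0 x y, k, z =>
      if k = k0 then
        (if z = y then x
         else if z = bottom m0 k x then top m0 k y
         else cA_1 m0 k z)
      else cA_1 m0 k z

/-- Precondition for inserting a dart. -/
def prec_I (m : Fmap) (x : Nat) : Prop := x ≠ nil ∧ ¬ exd m x

/-- Precondition for linking two darts at a dimension (keeping orbits open). -/
def prec_L (m : Fmap) (k : Dim) (x y : Nat) : Prop :=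
  exd m x ∧ exd m y ∧ ¬ succd m k x ∧ ¬ predd m k y ∧ cA m k x ≠ y

/-- The hypermap invariant. -/
def inv_hmap : Fmap → Prop
  | V => True
  | I m0 x => inv_hmap m0 ∧ prec_I m0 x
  | L m0 k0 x y => inv_hmap m0 ∧ prec_L m0 k0 x y

/-- The closed face map cF, corresponding to φ = α₁⁻¹ ∘ α₀⁻¹. -/
def cF (m : Fmap) (z : Nat) : Nat := cA_1 m Dim.one (cA_1 m Dim.zero z)

/-- Two darts are in the same face (existence of a cF-path). -/
def expf (m : Fmap) (z t : Nat) : Prop := exd m z ∧ ∃ n : ℕ, (cF m)^[n] z = t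

/-- Two darts are in the same edge (existence of a (cA zero)-path). -/
def expe (m : Fmap) (z t : Nat) : Prop := exd m z ∧ ∃ n : ℕ, (fun w => cA m Dim.zero w)^[n] z = t

/-- Two darts are in the same connected component. -/
def eqc : Fmap → Nat → Nat → Prop
  | V, _, _ => False
  | I m0 x, z, t => (z = x ∧ t = x) ∨ eqc m0 z t
  | L m0 _ x y, z, t =>
      eqc m0 z t ∨ (eqc m0 z x ∧ eqc m0 y t) ∨ (eqc m0 z y ∧ eqc m0 x t)

/-- Number of darts. -/
def nd : Fmap → ℤ
  | V => 0
  | I m0 _ => nd m0 + 1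
  | L m0 _ _ _ => nd m0

/-- Number of vertices. -/
def nv : Fmap → ℤ
  | V => 0
  | I m0 _ => nv m0 + 1
  | L m0 Dim.zero _ _ => nv m0
  | L m0 Dim.one _ _ => nv m0 - 1

/-- Number of edges. -/
def ne : Fmap → ℤ
  | V => 0
  | I m0 _ => ne m0 + 1
  | L m0 Dim.zero _ _ => ne m0 - 1
  | L m0 Dim.one _ _ => ne m0

/-- Number of faces. -/
noncomputable def nf : Fmap → ℤ
  | V => 0
  | I m0 _ => nf m0 + 1
  | L m0 Dim.zero x y => if expf m0 (cA_1 m0 Dim.one x) y then nf m0 + 1 else nf m0 - 1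
  | L m0 Dim.one x y => if expf m0 x (cA m0 Dim.zero y) then nf m0 + 1 else nf m0 - 1

/-- Number of connected components. -/
noncomputable def nc : Fmap → ℤ
  | V => 0
  | I m0 _ => nc m0 + 1
  | L m0 _ x y => if eqc m0 x y then nc m0 else nc m0 - 1

/-- Euler characteristic. -/
noncomputable def ec (m : Fmap) : ℤ := nv m + ne m + nf m - nd m

/-- Genus. -/
noncomputable def genus (m : Fmap) : ℤ := nc m - ec m / 2

/-- Planarity. -/
def planar (m : Fmap) : Prop := genus m = 0

/-- Breaking the latest forward k-link of x. -/
def B : Fmap → Dim → Nat → Fmap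
  | V, _, _ => V
  | I m0 x0, k, x => I (B m0 k x) x0
  | L m0 k0 x0 y0, k, x =>
      if k = k0 ∧ x = x0 then m0 else L (B m0 k x) k0 x0 y0

/-- Breaking all the 0-links of the darts of a list, first one first. -/
def Bl (m : Fmap) : List (Nat × Bool) → Fmap
  | [] => m
  | (x, _) :: l0 => Bl (B m Dim.zero x) l0

/-- The dart representing the face coded by a double-link (x, b). -/
def faceDart (m : Fmap) : Nat × Bool → Nat
  | (x, b) => if b then A m Dim.zero x else bottom m Dim.zero x

/-- The edge of x is distinct from the edges of the darts of a list. -/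
def distinct_edge_list (m : Fmap) (x : Nat) : List (Nat × Bool) → Prop
  | [] => True
  | (x', _) :: l0 => distinct_edge_list m x l0 ∧ ¬ expe m x x'

/-- Ring condition (0): unicity of edges, and each dart 0-linked. -/
def pre_ring0 (m : Fmap) : List (Nat × Bool) → Prop
  | [] => True
  | (x, _) :: l0 => pre_ring0 m l0 ∧ distinct_edge_list m x l0 ∧ succd m Dim.zero x

/-- Adjacency of the faces coded by two double-links. -/
def adjacent_faces (m : Fmap) : Nat × Bool → Nat × Bool → Prop
  | (x, b), (x', b') =>
      let y := A m Dim.zero x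
      let y' := A m Dim.zero x'
      let x0 := bottom m Dim.zero x
      let x'0 := bottom m Dim.zero x'
      if b then (if b' then expf m x0 y' else expf m x0 x'0)
      else (if b' then expf m y y' else expf m y x'0)

/-- Ring condition (1): continuity. -/
def pre_ring1 (m : Fmap) : List (Nat × Bool) → Prop
  | [] => True
  | xb :: l0 =>
      pre_ring1 m l0 ∧
      match l0 with
      | [] => True
      | xb' :: _ => adjacent_faces m xb xb'

/-- Last element of a list of double-links (with default). -/
def lastd : List (Nat × Bool) → Nat × Bool
  | [] => (nil, true)
  | [a] => a
  | _ :: a :: l0 => lastd (a :: l0)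

/-- Ring condition (2): circularity. -/
def pre_ring2 (m : Fmap) : List (Nat × Bool) → Prop
  | [] => True
  | (x, b) :: l0 =>
      match l0 with
      | [] => expf m (A m Dim.zero x) (bottom m Dim.zero x)
      | _ :: _ => adjacent_faces m (lastd l0) (x, b)

/-- The faces coded by two double-links are distinct. -/
def distinct_faces (m : Fmap) (xb xb' : Nat × Bool) : Prop :=
  ¬ expf m (faceDart m xb) (faceDart m xb')

/-- The face of xb is distinct from the faces of a list. -/
def distinct_face_list (m : Fmap) (xb : Nat × Bool) : List (Nat × Bool) → Prop
  | [] => True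
  | xb' :: l0 => distinct_face_list m xb l0 ∧ distinct_faces m xb xb'

/-- Ring condition (3): simplicity. -/
def pre_ring3 (m : Fmap) : List (Nat × Bool) → Prop
  | [] => True
  | xb :: l0 => pre_ring3 m l0 ∧ distinct_face_list m xb l0

/-- A ring of faces. -/
def ring (m : Fmap) (l : List (Nat × Bool)) : Prop :=
  l ≠ [] ∧ pre_ring0 m l ∧ pre_ring1 m l ∧ pre_ring2 m l ∧ pre_ring3 m l

end Fmap

open Fmap
namespace Fmap

/-- join of a setoid with one pair -/
def jn {α : Type} (r : Setoid α) (a b : α) : Setoid α where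
  r z t := r z t ∨ (r z a ∧ r b t) ∨ (r z b ∧ r a t)
  iseqv := by
    refine ⟨fun z => Or.inl (r.refl z), ?_, ?_⟩
    · rintro z t (h | ⟨h, h'⟩ | ⟨h, h'⟩)
      · exact Or.inl (r.symm h)
      · exact Or.inr (Or.inr ⟨r.symm h', r.symm h⟩)
      · exact Or.inr (Or.inl ⟨r.symm h', r.symm h⟩)
    · rintro z t u (h | ⟨h, h'⟩ | ⟨h, h'⟩) (k | ⟨k, k'⟩ | ⟨k, k'⟩)
      · exact Or.inl (r.trans h k)
      · exact Or.inr (Or.inl ⟨r.trans h k, k'⟩)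
      · exact Or.inr (Or.inr ⟨r.trans h k, k'⟩)
      · exact Or.inr (Or.inl ⟨h, r.trans h' k⟩)
      · exact Or.inr (Or.inl ⟨h, k'⟩)
      · exact Or.inl (r.trans h k')
      · exact Or.inr (Or.inr ⟨h, r.trans h' k⟩)
      · exact Or.inl (r.trans h k')
      · exact Or.inr (Or.inr ⟨h, k'⟩)

theorem jn_le {α : Type} (r s : Setoid α) (a b : α) : jn r a b ≤ s ↔ r ≤ s ∧ s a b := by
  constructor
  · intro h
    exact ⟨fun x y hx => h (Or.inl hx), h (Or.inr (Or.inl ⟨r.refl a, r.refl b⟩))⟩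
  · rintro ⟨h, hab⟩ z t (k | ⟨k, k'⟩ | ⟨k, k'⟩)
    · exact h k
    · exact s.trans (h k) (s.trans hab (h k'))
    · exact s.trans (h k) (s.trans (s.symm hab) (h k'))

theorem le_jn {α : Type} (r : Setoid α) (a b : α) : r ≤ jn r a b := fun _ _ h => Or.inl h

theorem jn_pair {α : Type} (r : Setoid α) (a b : α) : jn r a b a b :=
  Or.inr (Or.inl ⟨r.refl a, r.refl b⟩)

theorem jn_eq {α : Type} (r : Setoid α) (a b : α) (h : r a b) : jn r a b = r :=
  le_antisymm ((jn_le _ _ _ _).2 ⟨le_refl _, h⟩) (le_jn _ _ _)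

theorem jn_comm {α : Type} (r : Setoid α) (a b c d : α) :
    jn (jn r a b) c d = jn (jn r c d) a b := by
  have key : ∀ a b c d : α, jn (jn r a b) c d ≤ jn (jn r c d) a b := by
    intro a b c d
    rw [jn_le, jn_le]
    exact ⟨⟨(le_jn _ _ _).trans (le_jn _ _ _), jn_pair _ _ _⟩, le_jn _ _ _ (jn_pair _ _ _)⟩
  exact le_antisymm (key _ _ _ _) (key _ _ _ _)

theorem card_jn {α : Type} [Finite α] (r : Setoid α) (a b : α) (h : ¬ r a b) :
    Nat.card (Quotient (jn r a b)) + 1 = Nat.card (Quotient r) := by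
  classical
  have := Fintype.ofFinite (Quotient r)
  let f : {q : Quotient r // q ≠ Quotient.mk r b} → Quotient (jn r a b) :=
    fun q => Quotient.map' (s₁ := r) (s₂ := jn r a b) id (fun _ _ h => Or.inl h) q.1
  have hf : Function.Bijective f := by
    constructor
    · rintro ⟨q, hq⟩ ⟨q', hq'⟩ he
      induction q using Quotient.inductionOn with | _ z
      induction q' using Quotient.inductionOn with | _ t
      have h1 : ¬ r z b := fun k => hq (Quotient.sound k)
      have h2 : ¬ r t b := fun k => hq' (Quotient.sound k)
      have : jn r a b z t := Quotient.exact he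
      apply Subtype.ext
      apply Quotient.sound
      rcases this with k | ⟨k, k'⟩ | ⟨k, k'⟩
      · exact k
      · exact absurd (r.symm k') h2
      · exact absurd k h1
    · intro q
      induction q using Quotient.inductionOn with | _ z
      by_cases hz : r z b
      · refine ⟨⟨Quotient.mk r a, fun k => h (Quotient.exact k)⟩, ?_⟩
        apply Quotient.sound
        exact Or.inr (Or.inl ⟨r.refl a, r.symm hz⟩)
      · exact ⟨⟨Quotient.mk r z, fun k => hz (Quotient.exact k)⟩, rfl⟩
  rw [← Nat.card_eq_of_bijective f hf, Nat.card_eq_fintype_card, Nat.card_eq_fintype_card,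
    Fintype.card_subtype_compl]
  have : 0 < Fintype.card (Quotient r) := Fintype.card_pos_iff.2 ⟨Quotient.mk r b⟩
  simp
  omega

/-- number of classes of `r` on a finite set -/
noncomputable def cls (s : Finset ℕ) (r : Setoid ℕ) : ℤ :=
  (Nat.card (Quotient (r.comap (Subtype.val : s → ℕ))) : ℤ)

theorem cls_jn (s : Finset ℕ) (r : Setoid ℕ) (a b : ℕ) (ha : a ∈ s) (hb : b ∈ s) (h : ¬ r a b) :
    cls s (jn r a b) = cls s r - 1 := by
  have := card_jn (r.comap (Subtype.val : s → ℕ)) ⟨a, ha⟩ ⟨b, hb⟩ h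
  have e : jn (r.comap (Subtype.val : s → ℕ)) ⟨a, ha⟩ ⟨b, hb⟩
    = (jn r a b).comap (Subtype.val : s → ℕ) := rfl
  rw [e] at this
  unfold cls
  omega

theorem cls_bot (s : Finset ℕ) : cls s ⊥ = s.card := by
  unfold cls
  have : Function.Bijective (Quotient.mk ((⊥ : Setoid ℕ).comap (Subtype.val : s → ℕ))) := by
    constructor
    · intro a b h
      exact Subtype.ext (Quotient.exact h)
    · exact Quotient.mk_surjective
  rw [← Nat.card_eq_of_bijective _ this]
  simp

open Equiv Equiv.Perm

/-- cycles setoid -/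
def SC (σ : Perm ℕ) : Setoid ℕ := SameCycle.setoid σ

theorem SC_apply (σ : Perm ℕ) (z : ℕ) : SC σ (σ z) z :=
  show SameCycle σ (σ z) z from by simp [SameCycle.refl]

theorem SC_le (σ : Perm ℕ) (s : Setoid ℕ) (h : ∀ z, s (σ z) z) : SC σ ≤ s := by
  have hn : ∀ (n : ℕ) z, s ((σ ^ n) z) z := by
    intro n
    induction n with
    | zero => intro z; exact s.refl _
    | succ n ih =>
      intro z
      rw [pow_succ, Perm.mul_apply]
      exact s.trans (ih _) (h z)
  rintro z t ⟨i, hi⟩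
  rcases Int.eq_nat_or_neg i with ⟨n, rfl | rfl⟩
  · rw [zpow_natCast] at hi
    rw [← hi]
    exact s.symm (hn n z)
  · rw [zpow_neg, zpow_natCast, Perm.inv_eq_iff_eq] at hi
    rw [hi]
    exact hn n t

theorem SC_one : SC 1 = ⊥ := by
  apply le_antisymm _ bot_le
  exact SC_le _ _ (fun z => rfl)

theorem swap_rel (s : Setoid ℕ) (a b z : ℕ) (h : s a b) : s (swap a b z) z := by
  rw [swap_apply_def]
  split_ifs with h1 h2
  · subst h1; exact s.symm h
  · subst h2; exact h
  · exact s.refl _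

theorem SC_jn_le (σ : Perm ℕ) (a b : ℕ) : jn (SC (σ * swap a b)) a b ≤ jn (SC σ) a b := by
  rw [jn_le]
  refine ⟨SC_le _ _ fun z => ?_, jn_pair _ _ _⟩
  rw [Perm.mul_apply]
  exact Setoid.trans' _ (le_jn _ _ _ (SC_apply σ _)) (swap_rel _ a b z (jn_pair _ _ _))

theorem SC_jn_eq (σ : Perm ℕ) (a b : ℕ) : jn (SC (σ * swap a b)) a b = jn (SC σ) a b := by
  apply le_antisymm (SC_jn_le σ a b)
  have := SC_jn_le (σ * swap a b) a b
  rwa [mul_assoc, swap_mul_self, mul_one] at this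

/-- all orbits finite -/
def Fo (σ : Perm ℕ) : Prop := ∀ z, ∃ k, 0 < k ∧ (σ ^ k) z = z

theorem SC_nat {σ : Perm ℕ} (hf : Fo σ) {z t : ℕ} : SC σ z t ↔ ∃ n : ℕ, (σ ^ n) z = t := by
  constructor
  · have : ∀ z, ∃ n : ℕ, (σ ^ n) (σ z) = z := by
      intro z
      obtain ⟨k, hk, h⟩ := hf z
      refine ⟨k - 1, ?_⟩
      rw [← Perm.mul_apply, ← pow_succ, Nat.sub_add_cancel hk, h]
    let s : Setoid ℕ := {
      r := fun z t => (∃ n : ℕ, (σ ^ n) z = t) ∧ (∃ n : ℕ, (σ ^ n) t = z)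
      iseqv := ⟨fun z => ⟨⟨0, rfl⟩, ⟨0, rfl⟩⟩, fun h => ⟨h.2, h.1⟩, by
        rintro x y z ⟨⟨n, hn⟩, ⟨m, hm⟩⟩ ⟨⟨n', hn'⟩, ⟨m', hm'⟩⟩
        refine ⟨⟨n' + n, ?_⟩, ⟨m + m', ?_⟩⟩
        · rw [pow_add, Perm.mul_apply, hn, hn']
        · rw [pow_add, Perm.mul_apply, hm', hm]⟩ }
    intro h
    exact (SC_le σ s (fun z => ⟨this z, ⟨1, by simp⟩⟩) h).1
  · rintro ⟨n, rfl⟩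
    exact ⟨n, by simp⟩

theorem Fo_of (s : Finset ℕ) (σ : Perm ℕ) (h : ∀ z, z ∉ s → σ z = z) : Fo σ := by
  intro z
  by_cases hz : z ∈ s
  · have hs : ∀ z ∈ s, σ z ∈ s := by
      intro z hz
      by_contra hc
      have := σ.injective (h _ hc)
      rw [this] at hc
      exact hc hz
    have hp : ∀ n : ℕ, (σ ^ n) z ∈ s := by
      intro n
      induction n with
      | zero => exact hz
      | succ n ih => rw [pow_succ', Perm.mul_apply]; exact hs _ ih
    obtain ⟨i, j, hij, he⟩ :=
      Finite.exists_ne_map_eq_of_infinite (fun n : ℕ => (⟨(σ ^ n) z, hp n⟩ : s))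
    have he : (σ ^ i) z = (σ ^ j) z := congrArg Subtype.val he
    have key : ∀ i j : ℕ, i < j → (σ ^ i) z = (σ ^ j) z → ∃ k, 0 < k ∧ (σ ^ k) z = z := by
      intro i j hij he
      refine ⟨j - i, by omega, ?_⟩
      apply (σ ^ i).injective
      rw [← Perm.mul_apply, ← pow_add, he]
      congr 2; omega
    rcases lt_or_gt_of_ne hij with h1 | h1
    · exact key i j h1 he
    · exact key j i h1 he.symm
  · exact ⟨1, one_pos, by simpa using h z hz⟩

/-- following the same trajectory away from a and b -/
theorem traj (σ : Perm ℕ) (a b : ℕ) (k : ℕ)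
    (h : ∀ i, 0 < i → i < k → (σ ^ i) b ≠ a ∧ (σ ^ i) b ≠ b) :
    ∀ n, 0 < n → n ≤ k → ((σ * swap a b) ^ n) a = (σ ^ n) b := by
  intro n hn
  induction n, hn using Nat.le_induction with
  | base => intro _; simp
  | succ n hn ih =>
    intro hk
    rw [pow_succ', Perm.mul_apply, ih (by omega), Perm.mul_apply,
      swap_apply_of_ne_of_ne (h n hn (by omega)).1 (h n hn (by omega)).2, pow_succ', Perm.mul_apply]

theorem merge {σ : Perm ℕ} (hf : Fo σ) {a b : ℕ} (h : ¬ SC σ a b) :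
    SC (σ * swap a b) a b := by
  classical
  obtain ⟨hk, hb⟩ := Nat.find_spec (hf b)
  set k := Nat.find (hf b) with hkd
  have := traj σ a b k (by
    intro i hi hik
    constructor
    · intro hc
      exact h (Setoid.symm' _ ((SC_nat hf).2 ⟨i, hc⟩))
    · intro hc
      exact Nat.find_min (hf b) hik ⟨hi, hc⟩) k hk le_rfl
  rw [hb] at this
  exact ⟨k, by simpa using this⟩

theorem splitc {σ : Perm ℕ} (hf : Fo σ) {a b : ℕ} (hab : a ≠ b) (h : SC σ a b) :
    ¬ SC (σ * swap a b) a b := by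
  classical
  have hex : ∃ n : ℕ, (σ ^ n) b = a := (SC_nat hf).1 (Setoid.symm' _ h)
  have ha := Nat.find_spec hex
  set j := Nat.find hex with hj
  have hj0 : 0 < j := by
    rcases Nat.eq_zero_or_pos j with h0 | h0
    · rw [h0] at ha; exact absurd ha.symm hab
    · exact h0
  have hmin : ∀ i, i < j → (σ ^ i) b ≠ a := fun i hi => Nat.find_min hex hi
  have hnb : ∀ i, 0 < i → i ≤ j → (σ ^ i) b ≠ b := by
    intro i hi hij hc
    have : (σ ^ (j - i)) b = a := by
      conv_lhs => rw [← hc]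
      rw [← Perm.mul_apply, ← pow_add, Nat.sub_add_cancel hij, ha]
    exact hmin _ (by omega) this
  have T := traj σ a b j (fun i hi hij => ⟨hmin i hij, hnb i hi hij.le⟩)
  have hja : ((σ * swap a b) ^ j) a = a := by rw [T j hj0 le_rfl, ha]
  have hper : ∀ n : ℕ, ∃ i, 0 < i ∧ i ≤ j ∧ ((σ * swap a b) ^ n) a = (σ ^ i) b := by
    intro n
    induction n with
    | zero => exact ⟨j, hj0, le_rfl, by simp [ha]⟩
    | succ n ih =>
      obtain ⟨i, hi, hij, he⟩ := ih
      rcases Nat.lt_or_ge i j with hl | hl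
      · refine ⟨i + 1, by omega, by omega, ?_⟩
        rw [pow_succ', Perm.mul_apply, he, ← T i hi hij, ← Perm.mul_apply, ← pow_succ',
          T (i + 1) (by omega) (by omega)]
      · refine ⟨1, by omega, by omega, ?_⟩
        have : i = j := by omega
        rw [this, ha] at he
        rw [pow_succ', Perm.mul_apply, he]
        simp
  rintro ⟨i, hi⟩
  -- reduce integer exponent modulo j
  have hz : ((σ * swap a b) ^ (i % (j : ℤ))) a = b := by
    have e : i = i % (j : ℤ) + (j : ℤ) * (i / (j : ℤ)) := (Int.emod_add_mul_ediv i j).symm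
    rw [e, zpow_add, Perm.mul_apply, zpow_mul, zpow_natCast,
      Perm.zpow_apply_eq_self_of_apply_eq_self hja] at hi
    exact hi
  have hnn : 0 ≤ i % (j : ℤ) := Int.emod_nonneg _ (by omega)
  obtain ⟨n, hn⟩ := Int.eq_ofNat_of_zero_le hnn
  rw [hn, zpow_natCast] at hz
  obtain ⟨i', hi', hij', he⟩ := hper n
  exact hnb i' hi' hij' (he.symm.trans hz)

theorem cls_swap (s : Finset ℕ) {σ : Perm ℕ} (hf : Fo σ) {a b : ℕ} (ha : a ∈ s) (hb : b ∈ s)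
    (hab : a ≠ b) :
    cls s (SC (σ * swap a b)) = if SC σ a b then cls s (SC σ) + 1 else cls s (SC σ) - 1 := by
  have hj := SC_jn_eq σ a b
  split_ifs with h
  · have h2 := splitc hf hab h
    have := cls_jn s _ a b ha hb h2
    rw [hj, jn_eq _ _ _ h] at this
    omega
  · have h2 := merge hf h
    have := cls_jn s _ a b ha hb h
    rw [← hj, jn_eq _ _ _ h2] at this
    omega

theorem exd_ne_nil : ∀ {m : Fmap}, inv_hmap m → ∀ {z}, exd m z → z ≠ nil
  | V, _, _, h => h.elim
  | I m0 x, hi, z, h => by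
    rcases h with h | h
    · rw [h]; exact hi.2.1
    · exact exd_ne_nil hi.1 h
  | L m0 _ _ _, hi, z, h => exd_ne_nil (m := m0) hi.1 h

/-- Open-orbit facts. -/
theorem facts (k : Dim) : ∀ {m : Fmap}, inv_hmap m → ∀ z, exd m z →
    exd m (bottom m k z) ∧ exd m (top m k z) ∧
    (¬ succd m k z → top m k z = z) ∧ (¬ predd m k z → bottom m k z = z) ∧
    bottom m k (top m k z) = bottom m k z ∧ top m k (bottom m k z) = top m k z ∧
    (¬ succd m k z → cA m k z = bottom m k z) ∧ (¬ predd m k z → cA_1 m k z = top m k z)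
  | V, _, _, h => h.elim
  | I m x, hi, z, h => by
    have ih := facts k (m := m) hi.1 z
    have hx := hi.2.2
    simp only [exd, succd, predd, A, A_1, bottom, top, cA, cA_1] at *
    by_cases hz : z = x
    · simp [hz]
    · have hz' : exd m z := by tauto
      obtain ⟨i1, i2, i3, i4, i5, i6, i7, i8⟩ := ih hz'
      have e1 : bottom m k z ≠ x := fun e => hx (e ▸ i1)
      have e2 : top m k z ≠ x := fun e => hx (e ▸ i2)
      simp only [hz, e1, e2, if_false]
      exact ⟨Or.inr i1, Or.inr i2, i3, i4, i5, i6, i7, i8⟩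
  | L m k0 x y, hi, z, h => by
    have ih := fun z => facts k (m := m) hi.1 z
    obtain ⟨hm, hx, hy, hsx, hpy, hc⟩ := hi
    have hxn := exd_ne_nil hm hx
    have hyn := exd_ne_nil hm hy
    replace h : exd m z := h
    by_cases hk : k = k0
    · subst hk
      obtain ⟨i1, i2, i3, i4, i5, i6, i7, i8⟩ := ih z h
      obtain ⟨x1, x2, x3, x4, x5, x6, x7, x8⟩ := ih x hx
      obtain ⟨y1, y2, y3, y4, y5, y6, y7, y8⟩ := ih y hy
      have x3 := x3 hsx
      have x7 := x7 hsx
      have y4 := y4 hpy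
      have y8 := y8 hpy
      simp only [exd, succd, predd, A, A_1, bottom, top, cA, cA_1, if_true] at *
      refine ⟨?_, ?_, ?_, ?_, ?_, ?_, ?_, ?_⟩ <;> grind
    · simp only [exd, succd, predd, A, A_1, bottom, top, cA, cA_1, hk, if_false] at *
      exact ih z h

/-- the permutation `cA_1` extended by the identity -/
noncomputable def P : Fmap → Dim → Perm ℕ
  | V, _ => 1
  | I m _, k => P m k
  | L m k0 x y, k => if k = k0 then P m k * swap y (bottom m k x) else P m k

theorem P_out (k : Dim) : ∀ {m : Fmap}, inv_hmap m → ∀ {z}, ¬ exd m z → P m k z = z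
  | V, _, _, _ => rfl
  | I m x, hi, z, h => P_out k (m := m) hi.1 (fun h' => h (Or.inr h'))
  | L m k0 x y, hi, z, h => by
    replace h : ¬ exd m z := h
    have ih := P_out k hi.1 h
    obtain ⟨hm, hx, hy, hsx, hpy, hc⟩ := hi
    have hb := (facts k hm x hx).1
    simp only [P]
    split_ifs
    · rw [Perm.mul_apply, swap_apply_of_ne_of_ne, ih]
      · rintro rfl; exact h hy
      · rintro rfl; exact h hb
    · exact ih

theorem P_exd (k : Dim) {m : Fmap} (hi : inv_hmap m) {z} : exd m (P m k z) ↔ exd m z := by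
  by_cases h : exd m z
  · refine ⟨fun _ => h, fun _ => ?_⟩
    by_contra hc
    have := (P m k).injective (P_out k hi hc)
    rw [this] at hc
    exact hc h
  · rw [P_out k hi h]

theorem P_cA_1 (k : Dim) : ∀ {m : Fmap}, inv_hmap m → ∀ {z}, exd m z →
    P m k z = cA_1 m k z ∧ (P m k)⁻¹ z = cA m k z
  | V, _, _, h => h.elim
  | I m x, hi, z, h => by
    have ih := fun h => P_cA_1 k (m := m) hi.1 (z := z) h
    have ho := P_out k (m := m) hi.1 hi.2.2
    simp only [P, cA, cA_1, exd] at *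
    by_cases hz : z = x
    · subst hz
      simp only [if_true]
      exact ⟨ho, by rw [Perm.inv_eq_iff_eq, ho]⟩
    · simp only [hz, if_false]
      exact ih (by tauto)
  | L m k0 x y, hi, z, h => by
    replace h : exd m z := h
    have ih := fun z h => P_cA_1 k (m := m) hi.1 (z := z) h
    obtain ⟨hm, hx, hy, hsx, hpy, hc⟩ := hi
    by_cases hk : k = k0
    · subst hk
      obtain ⟨x1, x2, x3, x4, x5, x6, x7, x8⟩ := facts k hm x hx
      obtain ⟨y1, y2, y3, y4, y5, y6, y7, y8⟩ := facts k hm y hy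
      have x7 := x7 hsx
      have y8 := y8 hpy
      have ix := (ih x hx).2
      have iy := (ih y hy).1
      rw [x7] at ix hc
      rw [y8] at iy
      have ix' : P m k (bottom m k x) = x := by rw [← ix]; simp
      have iy' : (P m k)⁻¹ (top m k y) = y := by rw [← iy]; simp
      simp only [P, cA, cA_1, if_true, mul_inv_rev, swap_inv, Perm.mul_apply]
      constructor
      · by_cases h1 : z = y
        · simp [h1, ix']
        · by_cases h2 : z = bottom m k x
          · simp [h2, iy, hc]
          · rw [swap_apply_of_ne_of_ne h1 h2, if_neg h1, if_neg h2]
            exact (ih z h).1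
      · by_cases h1 : z = x
        · rw [h1, ix]; simp
        · by_cases h2 : z = top m k y
          · rw [if_neg h1, if_pos h2, h2, iy']; simp
          · rw [swap_apply_of_ne_of_ne, if_neg h1, if_neg h2]
            · exact (ih z h).2
            · intro e; apply h2; rw [← iy, ← e]; simp
            · intro e; apply h1; rw [← ix', ← e]; simp
    · simp only [P, cA, cA_1, hk, if_false]
      exact ih z h

/-- component relation -/
def R : Fmap → Setoid ℕ
  | V => ⊥
  | I m _ => R m
  | L m _ x y => jn (R m) x y

theorem R_out : ∀ {m : Fmap}, inv_hmap m → ∀ {z t}, R m z t → ¬ exd m z → z = t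
  | V, _, _, _, h, _ => h
  | I m x, hi, z, t, h, h' => R_out (m := m) hi.1 h (fun k => h' (Or.inr k))
  | L m k0 x y, hi, z, t, h, h' => by
    obtain ⟨hm, hx, hy, -⟩ := hi
    replace h' : ¬ exd m z := h'
    rcases h with h | ⟨h, -⟩ | ⟨h, -⟩
    · exact R_out hm h h'
    · have := R_out hm h h'; subst this; exact absurd hx h'
    · have := R_out hm h h'; subst this; exact absurd hy h'

theorem R_exd {m : Fmap} (hm : inv_hmap m) {z t} (h : R m z t) : exd m z ↔ exd m t := by
  constructor
  · intro hz
    by_contra hc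
    exact hc (R_out hm (Setoid.symm' _ h) hc ▸ hz)
  · intro hz
    by_contra hc
    exact hc (R_out hm h hc ▸ hz)

theorem eqc_iff : ∀ {m : Fmap}, inv_hmap m → ∀ {z t}, eqc m z t ↔ exd m z ∧ R m z t
  | V, _, _, _ => by simp [eqc, exd]
  | I m x, hi, z, t => by
    have ih := eqc_iff (m := m) hi.1 (z := z) (t := t)
    simp only [eqc, exd, R, ih]
    constructor
    · rintro (⟨rfl, rfl⟩ | h)
      · exact ⟨Or.inl rfl, Setoid.refl' _ _⟩
      · exact ⟨Or.inr h.1, h.2⟩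
    · rintro ⟨h | h, h'⟩
      · subst h; exact Or.inl ⟨rfl, (R_out hi.1 h' hi.2.2).symm⟩
      · exact Or.inr ⟨h, h'⟩
  | L m k0 x y, hi, z, t => by
    have ih := fun z t => eqc_iff (m := m) hi.1 (z := z) (t := t)
    obtain ⟨hm, hx, hy, -⟩ := hi
    simp only [eqc, exd, ih]
    change _ ↔ exd m z ∧ (R m z t ∨ (R m z x ∧ R m y t) ∨ (R m z y ∧ R m x t))
    tauto

theorem R_bottom (k : Dim) : ∀ {m : Fmap}, inv_hmap m → ∀ {z}, exd m z → R m (bottom m k z) z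
  | V, _, _, h => h.elim
  | I m x, hi, z, h => by
    simp only [bottom, R]
    split_ifs with hz
    · exact Setoid.refl' _ _
    · exact R_bottom k hi.1 (h.resolve_left hz)
  | L m k0 x y, hi, z, h => by
    have iz := R_bottom k (m := m) hi.1 (z := z) h
    have ix := R_bottom k (m := m) hi.1 (z := x) hi.2.1
    simp only [bottom, R]
    split_ifs with hk hz
    · rw [hz] at iz
      exact Or.inr (Or.inl ⟨ix, iz⟩)
    · exact Or.inl iz
    · exact Or.inl iz

theorem R_P (k : Dim) : ∀ {m : Fmap}, inv_hmap m → ∀ z, R m (P m k z) z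
  | V, _, _ => rfl
  | I m x, hi, z => R_P k (m := m) hi.1 z
  | L m k0 x y, hi, z => by
    have ih := fun z => R_P k (m := m) hi.1 z
    have hb := R_bottom k (m := m) hi.1 (z := x) hi.2.1
    simp only [P, R]
    split_ifs
    · rw [Perm.mul_apply]
      refine Setoid.trans' _ (le_jn _ _ _ (ih _)) (swap_rel _ _ _ _ ?_)
      exact Setoid.trans' _ (Setoid.symm' _ (jn_pair _ _ _)) (le_jn _ _ _ (Setoid.symm' _ hb))
    · exact Or.inl (ih z)

/-- face permutation -/
noncomputable def Q (m : Fmap) : Perm ℕ := P m Dim.one * P m Dim.zero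

theorem Q_out {m : Fmap} (hi : inv_hmap m) {z} (h : ¬ exd m z) : Q m z = z := by
  rw [Q, Perm.mul_apply, P_out _ hi h, P_out _ hi h]

theorem Q_exd {m : Fmap} (hi : inv_hmap m) {z} : exd m (Q m z) ↔ exd m z := by
  rw [Q, Perm.mul_apply, P_exd _ hi, P_exd _ hi]

theorem Q_cF {m : Fmap} (hi : inv_hmap m) {z} (h : exd m z) : Q m z = cF m z := by
  rw [Q, Perm.mul_apply, cF, ← (P_cA_1 _ hi h).1, ← (P_cA_1 _ hi ((P_exd _ hi).2 h)).1]

theorem R_Q {m : Fmap} (hi : inv_hmap m) : SC (Q m) ≤ R m := by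
  apply SC_le
  intro z
  rw [Q, Perm.mul_apply]
  exact Setoid.trans' _ (R_P _ hi _) (R_P _ hi _)

theorem exd_fin : ∀ m : Fmap, ∃ s : Finset ℕ, ∀ z, exd m z → z ∈ s
  | V => ⟨∅, fun _ h => h.elim⟩
  | I m x => by
    obtain ⟨s, hs⟩ := exd_fin m
    exact ⟨insert x s, fun z h => by
      rcases h with h | h
      · simp [h]
      · simp [hs z h]⟩
  | L m _ _ _ => exd_fin m

theorem Q_Fo {m : Fmap} (hi : inv_hmap m) : Fo (Q m) := by
  obtain ⟨s, hs⟩ := exd_fin m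
  exact Fo_of s _ fun z hz => Q_out hi fun h => hz (hs z h)

theorem expf_iff {m : Fmap} (hi : inv_hmap m) {z t} (h : exd m z) : expf m z t ↔ SC (Q m) z t := by
  have key : ∀ n : ℕ, (cF m)^[n] z = ((Q m) ^ n) z ∧ exd m (((Q m) ^ n) z) := by
    intro n
    induction n with
    | zero => exact ⟨rfl, h⟩
    | succ n ih =>
      rw [Function.iterate_succ_apply', ih.1, pow_succ', Perm.mul_apply, Q_cF hi ih.2]
      refine ⟨rfl, ?_⟩
      rw [← Q_cF hi ih.2]
      exact (Q_exd hi).2 ih.2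
  rw [SC_nat (Q_Fo hi), expf]
  simp [h, fun n => (key n).1]

theorem nc_eq (s : Finset ℕ) : ∀ {m : Fmap}, inv_hmap m → (∀ z, exd m z → z ∈ s) →
    nc m = cls s (R m) - s.card + nd m
  | V, _, _ => by simp [nc, R, cls_bot, nd]
  | I m x, hi, hs => by
    have ih := nc_eq s (m := m) hi.1 (fun z h => hs z (Or.inr h))
    simp only [nc, R, nd, ih]; ring
  | L m k x y, hi, hs => by
    have ih := nc_eq s (m := m) hi.1 hs
    obtain ⟨hm, hx, hy, -⟩ := hi
    simp only [nc, R, nd, ih, eqc_iff hm]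
    split_ifs with h
    · rw [jn_eq _ _ _ h.2]
    · rw [cls_jn s _ _ _ (hs x hx) (hs y hy) (fun k => h ⟨hx, k⟩)]; ring

/-- the face test in dimension 0 -/
theorem face0 {m : Fmap} {x y} (hi : inv_hmap (L m Dim.zero x y)) :
    expf m (cA_1 m Dim.one x) y ↔ SC (Q m) y (bottom m Dim.zero x) := by
  obtain ⟨hm, hx, hy, hsx, hpy, hc⟩ := hi
  have hb := facts Dim.zero hm x hx
  have e : P m Dim.zero (bottom m Dim.zero x) = x := by
    rw [← hb.2.2.2.2.2.2.1 hsx, ← (P_cA_1 _ hm hx).2]; simp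
  have e2 : cA_1 m Dim.one x = Q m (bottom m Dim.zero x) := by
    rw [Q, Perm.mul_apply, e, (P_cA_1 _ hm hx).1]
  rw [e2, expf_iff hm ((Q_exd hm).2 hb.1)]
  have h3 := SC_apply (Q m) (bottom m Dim.zero x)
  exact ⟨fun h => Setoid.trans' _ (Setoid.symm' _ h) h3,
    fun h => Setoid.trans' _ h3 (Setoid.symm' _ h)⟩

theorem face1 {m : Fmap} {x y} (hi : inv_hmap (L m Dim.one x y)) :
    expf m x (cA m Dim.zero y) ↔
      SC (Q m) ((P m Dim.zero)⁻¹ y) ((P m Dim.zero)⁻¹ (bottom m Dim.one x)) := by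
  obtain ⟨hm, hx, hy, hsx, hpy, hc⟩ := hi
  have hb := facts Dim.one hm x hx
  have e : P m Dim.one (bottom m Dim.one x) = x := by
    rw [← hb.2.2.2.2.2.2.1 hsx, ← (P_cA_1 _ hm hx).2]; simp
  have e2 : Q m ((P m Dim.zero)⁻¹ (bottom m Dim.one x)) = x := by
    rw [Q, Perm.mul_apply]; simp [e]
  rw [expf_iff hm hx, ← (P_cA_1 _ hm hy).2]
  have h3 := SC_apply (Q m) ((P m Dim.zero)⁻¹ (bottom m Dim.one x))
  rw [e2] at h3
  exact ⟨fun h => Setoid.trans' _ (Setoid.symm' _ h) h3,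
    fun h => Setoid.trans' _ h3 (Setoid.symm' _ h)⟩

theorem nf_eq (s : Finset ℕ) : ∀ {m : Fmap}, inv_hmap m → (∀ z, exd m z → z ∈ s) →
    nf m = cls s (SC (Q m)) - s.card + nd m
  | V, _, _ => by
    have : Q V = 1 := by simp [Q, P]
    simp [nf, this, SC_one, cls_bot, nd]
  | I m x, hi, hs => by
    have ih := nf_eq s (m := m) hi.1 (fun z h => hs z (Or.inr h))
    have : Q (I m x) = Q m := rfl
    simp only [nf, this, nd, ih]; ring
  | L m Dim.zero x y, hi, hs => by
    have ih := nf_eq s (m := m) hi.1 hs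
    have hf := face0 hi
    obtain ⟨hm, hx, hy, hsx, hpy, hc⟩ := hi
    have hb := facts Dim.zero hm x hx
    rw [hb.2.2.2.2.2.2.1 hsx] at hc
    have : Q (L m Dim.zero x y) = Q m * swap y (bottom m Dim.zero x) := by
      simp [Q, P, mul_assoc]
    rw [this, cls_swap s (Q_Fo hm) (hs y hy) (hs _ hb.1) hc.symm]
    simp only [nf, nd, ih, hf]
    split_ifs <;> ring
  | L m Dim.one x y, hi, hs => by
    have ih := nf_eq s (m := m) hi.1 hs
    have hf := face1 hi
    obtain ⟨hm, hx, hy, hsx, hpy, hc⟩ := hi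
    have hb := facts Dim.one hm x hx
    rw [hb.2.2.2.2.2.2.1 hsx] at hc
    have : Q (L m Dim.one x y) = Q m * swap ((P m Dim.zero)⁻¹ y)
        ((P m Dim.zero)⁻¹ (bottom m Dim.one x)) := by
      simp only [Q, P, if_true, reduceCtorEq, if_false]
      rw [mul_assoc, swap_mul_eq_mul_swap, mul_assoc]
    have hin : ∀ z, exd m z → exd m ((P m Dim.zero)⁻¹ z) := by
      intro z hz
      rw [← P_exd Dim.zero hm]; simpa using hz
    rw [this, cls_swap s (Q_Fo hm) (hs _ (hin y hy)) (hs _ (hin _ hb.1))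
      (fun e => hc.symm ((P m Dim.zero)⁻¹.injective e))]
    simp only [nf, nd, ih, hf]
    split_ifs <;> ring

theorem face_comp0 {m : Fmap} {x y} (hi : inv_hmap (L m Dim.zero x y))
    (h : expf m (cA_1 m Dim.one x) y) : eqc m x y := by
  have h1 := R_Q hi.1 ((face0 hi).1 h)
  have hb := R_bottom Dim.zero hi.1 hi.2.1
  exact (eqc_iff hi.1).2 ⟨hi.2.1, Setoid.symm' _ (Setoid.trans' _ h1 hb)⟩

theorem face_comp1 {m : Fmap} {x y} (hi : inv_hmap (L m Dim.one x y))
    (h : expf m x (cA m Dim.zero y)) : eqc m x y := by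
  have h1 := R_Q hi.1 ((expf_iff hi.1 hi.2.1).1 h)
  rw [← (P_cA_1 _ hi.1 hi.2.2.1).2] at h1
  have h2 := R_P Dim.zero hi.1 ((P m Dim.zero)⁻¹ y)
  have e : P m Dim.zero ((P m Dim.zero)⁻¹ y) = y := by simp
  rw [e] at h2
  exact (eqc_iff hi.1).2 ⟨hi.2.1, Setoid.trans' _ h1 (Setoid.symm' _ h2)⟩

theorem genus_nonneg : ∀ {m : Fmap}, inv_hmap m → 0 ≤ genus m
  | V, _ => by simp [genus, nc, ec, nv, ne, nf, nd]
  | I m x, hi => by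
    have ih := genus_nonneg hi.1
    simp only [genus, nc, ec, nv, ne, nf, nd] at *
    omega
  | L m Dim.zero x y, hi => by
    have ih := genus_nonneg hi.1
    have hc := face_comp0 hi
    simp only [genus, nc, ec, nv, ne, nf, nd] at *
    split_ifs <;> first | omega | tauto
  | L m Dim.one x y, hi => by
    have ih := genus_nonneg hi.1
    have hc := face_comp1 hi
    simp only [genus, nc, ec, nv, ne, nf, nd] at *
    split_ifs <;> first | omega | tauto

structure Sim (m m' : Fmap) : Prop where
  nd : nd m = nd m'
  nv : nv m = nv m'
  ne : ne m = ne m'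
  exd : ∀ z, exd m z ↔ exd m' z
  A : ∀ k z, A m k z = A m' k z
  A_1 : ∀ k z, A_1 m k z = A_1 m' k z
  bot : ∀ k z, bottom m k z = bottom m' k z
  P : ∀ k, P m k = P m' k
  R : R m = R m'

theorem Sim.rfl' (m : Fmap) : Sim m m :=
  ⟨rfl, rfl, rfl, fun _ => Iff.rfl, fun _ _ => rfl, fun _ _ => rfl, fun _ _ => rfl,
    fun _ => rfl, rfl⟩

theorem Sim.trans' {a b c : Fmap} (h : Sim a b) (k : Sim b c) : Sim a c :=
  ⟨h.nd.trans k.nd, h.nv.trans k.nv, h.ne.trans k.ne, fun z => (h.exd z).trans (k.exd z),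
    fun i z => (h.A i z).trans (k.A i z), fun i z => (h.A_1 i z).trans (k.A_1 i z),
    fun i z => (h.bot i z).trans (k.bot i z), fun i => (h.P i).trans (k.P i), h.R.trans k.R⟩

theorem prec_L_iff {m : Fmap} (hm : inv_hmap m) {k x y} : prec_L m k x y ↔
    exd m x ∧ exd m y ∧ A m k x = nil ∧ A_1 m k y = nil ∧ bottom m k x ≠ y := by
  unfold prec_L
  constructor
  · rintro ⟨hx, hy, h1, h2, h3⟩
    have := (facts k hm x hx).2.2.2.2.2.2.1 h1
    rw [this] at h3
    exact ⟨hx, hy, not_not.1 h1, not_not.1 h2, h3⟩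
  · rintro ⟨hx, hy, h1, h2, h3⟩
    have := (facts k hm x hx).2.2.2.2.2.2.1 (not_not.2 h1)
    rw [this]
    exact ⟨hx, hy, not_not.2 h1, not_not.2 h2, h3⟩

theorem congr_I {m m' : Fmap} {w} (h : Sim m m') (hm' : inv_hmap m') (hi : inv_hmap (I m w)) :
    inv_hmap (I m' w) ∧ Sim (I m w) (I m' w) := by
  refine ⟨⟨hm', hi.2.1, fun k => hi.2.2 ((h.exd w).2 k)⟩, ?_⟩
  constructor
  · simp [Fmap.nd, h.nd]
  · simp [Fmap.nv, h.nv]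
  · simp [Fmap.ne, h.ne]
  · simp [Fmap.exd, h.exd]
  · exact h.A
  · exact h.A_1
  · simp [Fmap.bottom, h.bot]
  · exact h.P
  · exact h.R

theorem congr_L {m m' : Fmap} {k x y} (h : Sim m m') (hm' : inv_hmap m')
    (hi : inv_hmap (L m k x y)) :
    inv_hmap (L m' k x y) ∧ Sim (L m k x y) (L m' k x y) := by
  constructor
  · refine ⟨hm', ?_⟩
    have := (prec_L_iff hi.1).1 hi.2
    rw [prec_L_iff hm', ← h.exd, ← h.exd, ← h.A, ← h.A_1, ← h.bot]
    exact this
  constructor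
  · simp [Fmap.nd, h.nd]
  · cases k <;> simp [Fmap.nv, h.nv]
  · cases k <;> simp [Fmap.ne, h.ne]
  · exact h.exd
  · simp [Fmap.A, h.A]
  · simp [Fmap.A_1, h.A_1]
  · simp [Fmap.bottom, h.bot]
  · simp [Fmap.P, h.P, h.bot]
  · simp [Fmap.R, h.R]

theorem swap_I {m : Fmap} {k x y w} (hi : inv_hmap (I (L m k x y) w)) :
    inv_hmap (L (I m w) k x y) ∧ Sim (I (L m k x y) w) (L (I m w) k x y) := by
  obtain ⟨⟨hm, hL⟩, hw, hw'⟩ := hi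
  replace hw' : ¬ exd m w := hw'
  have hp := (prec_L_iff hm).1 hL
  have hIm : inv_hmap (I m w) := ⟨hm, hw, hw'⟩
  have hxw : x ≠ w := fun e => hw' (e ▸ hp.1)
  have hyw : w ≠ y := fun e => hw' (e ▸ hp.2.1)
  constructor
  · refine ⟨hIm, (prec_L_iff hIm).2 ⟨Or.inr hp.1, Or.inr hp.2.1, hp.2.2.1, hp.2.2.2.1, ?_⟩⟩
    simp only [bottom, hxw, if_false]
    exact hp.2.2.2.2
  constructor
  · rfl
  · cases k <;> simp only [nv] <;> ring
  · cases k <;> simp only [ne] <;> ring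
  · intro z; rfl
  · intro _ z; rfl
  · intro _ z; rfl
  · intro k' z
    simp only [bottom, hxw, if_false]
    split_ifs <;> simp_all
  · intro k'
    simp only [P, bottom, hxw, if_false]
  · rfl

theorem swap_ident {a b c d : ℕ} (hab : b ≠ a) (hac : a ≠ c) (hbd : b ≠ d)
    (h : (if d = a then b else d) ≠ c) :
    swap a b * swap c (if d = a then b else d) = swap c d * swap a (if b = c then d else b) := by
  ext z
  simp only [Perm.mul_apply, swap_apply_def]
  grind

theorem swap_L {m : Fmap} {k x y k0 x0 y0} (hi : inv_hmap (L (L m k x y) k0 x0 y0)) :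
    inv_hmap (L (L m k0 x0 y0) k x y) ∧
      Sim (L (L m k x y) k0 x0 y0) (L (L m k0 x0 y0) k x y) := by
  obtain ⟨⟨hm, hL⟩, hL0⟩ := hi
  have hL0 := (prec_L_iff (m := L m k x y) ⟨hm, hL⟩).1 hL0
  have hL := (prec_L_iff hm).1 hL
  obtain ⟨hx, hy, hA, hA1, hb⟩ := hL
  obtain ⟨hx0, hy0, hA0, hA10, hb0⟩ := hL0
  replace hx0 : exd m x0 := hx0
  replace hy0 : exd m y0 := hy0
  have hxn := exd_ne_nil hm hx
  have hyn := exd_ne_nil hm hy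
  have hx0n := exd_ne_nil hm hx0
  have hy0n := exd_ne_nil hm hy0
  by_cases hk : k = k0
  · subst hk
    have hxx : x ≠ x0 := by
      rintro rfl
      simp [A] at hA0
      exact hyn hA0
    have hyy : y ≠ y0 := by
      rintro rfl
      simp [A_1] at hA10
      exact hxn hA10
    simp only [A, A_1, bottom, if_true, hxx.symm, hyy.symm, if_false] at hA0 hA10 hb0
    have hbb : bottom m k x ≠ bottom m k x0 := by
      intro e
      obtain ⟨x1, x2, x3, x4, x5, x6, x7, x8⟩ := facts k hm x hx
      obtain ⟨y1, y2, y3, y4, y5, y6, y7, y8⟩ := facts k hm x0 hx0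
      have x3 := x3 (not_not.2 hA)
      have y3 := y3 (not_not.2 hA0)
      apply hxx
      rw [← x3, ← y3, ← x6, ← y6, e]
    have hi1 : inv_hmap (L m k x0 y0) := by
      refine ⟨hm, (prec_L_iff hm).2 ⟨hx0, hy0, hA0, hA10, ?_⟩⟩
      grind
    refine ⟨⟨hi1, (prec_L_iff hi1).2 ⟨hx, hy, ?_, ?_, ?_⟩⟩, ?_⟩
    · simp [A, hxx, hA]
    · simp [A_1, hyy, hA1]
    · simp only [bottom, if_true]
      grind
    constructor
    · rfl
    · cases k <;> simp only [nv]
    · cases k <;> simp only [ne]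
    · intro z; rfl
    · intro k' z; simp only [A]; grind
    · intro k' z; simp only [A_1]; grind
    · intro k' z; simp only [bottom]; grind
    · intro k'
      simp only [P]
      split_ifs with h
      · subst h
        simp only [bottom, if_true]
        rw [mul_assoc, mul_assoc, swap_ident hb hyy hbb hb0]
      · rfl
    · exact jn_comm _ _ _ _ _
  · have hk' : k0 ≠ k := fun e => hk e.symm
    simp only [A, A_1, bottom, hk', if_false] at hA0 hA10 hb0
    have hi1 : inv_hmap (L m k0 x0 y0) :=
      ⟨hm, (prec_L_iff hm).2 ⟨hx0, hy0, hA0, hA10, hb0⟩⟩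
    refine ⟨⟨hi1, (prec_L_iff hi1).2 ⟨hx, hy, ?_, ?_, ?_⟩⟩, ?_⟩
    · simp [A, hk, hA]
    · simp [A_1, hk, hA1]
    · simp [bottom, hk, hb]
    constructor
    · rfl
    · cases k <;> cases k0 <;> simp only [nv]
    · cases k <;> cases k0 <;> simp only [ne]
    · intro z; rfl
    · intro k' z; simp only [A]; grind
    · intro k' z; simp only [A_1]; grind
    · intro k' z; simp only [bottom]; grind
    · intro k'
      simp only [P, bottom, hk, hk', if_false]
      split_ifs with h h' <;> first | rfl | (exfalso; exact hk (by rw [← h, ← h'])) | (exfalso; exact hk (by rw [← h', ← h])) | simp_all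
    · exact jn_comm _ _ _ _ _

theorem B_sim (x : ℕ) : ∀ {m : Fmap}, inv_hmap m → succd m Dim.zero x →
    inv_hmap (L (B m Dim.zero x) Dim.zero x (A m Dim.zero x)) ∧
      Sim m (L (B m Dim.zero x) Dim.zero x (A m Dim.zero x))
  | V, _, h => (h rfl).elim
  | I m w, hi, h => by
    obtain ⟨h1, h2⟩ := B_sim x (m := m) hi.1 h
    obtain ⟨h3, h4⟩ := congr_I h2 h1 hi
    obtain ⟨h5, h6⟩ := swap_I h3
    exact ⟨h5, h4.trans' h6⟩
  | L m k0 x0 y0, hi, h => by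
    by_cases hc : Dim.zero = k0 ∧ x = x0
    · have e : B (L m k0 x0 y0) Dim.zero x = m := by simp only [B, if_pos hc]
      obtain ⟨rfl, rfl⟩ := hc
      have e2 : A (L m Dim.zero x y0) Dim.zero x = y0 := by simp [A]
      rw [e, e2]
      exact ⟨hi, Sim.rfl' _⟩
    · have e : B (L m k0 x0 y0) Dim.zero x = L (B m Dim.zero x) k0 x0 y0 := by
        simp only [B, if_neg hc]
      have e2 : A (L m k0 x0 y0) Dim.zero x = A m Dim.zero x := by
        simp only [A]; grind
      rw [succd, e2] at h
      obtain ⟨h1, h2⟩ := B_sim x (m := m) hi.1 h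
      obtain ⟨h3, h4⟩ := congr_L h2 h1 hi
      obtain ⟨h5, h6⟩ := swap_L h3
      rw [e, e2]
      exact ⟨h5, h4.trans' h6⟩

theorem Sim.genus {m m' : Fmap} (h : Sim m m') (hm : inv_hmap m) (hm' : inv_hmap m') :
    genus m = genus m' := by
  obtain ⟨s, hs⟩ := exd_fin m
  have hs' : ∀ z, Fmap.exd m' z → z ∈ s := fun z hz => hs z ((h.exd z).2 hz)
  unfold Fmap.genus ec
  rw [nc_eq s hm hs, nc_eq s hm' hs', nf_eq s hm hs, nf_eq s hm' hs', Q, Q, h.P, h.P, h.R, h.nd,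
    h.nv, h.ne]

end Fmap

/-- Planarity criterion for 0-link breaking. -/
theorem planarity_crit_B0 (m : Fmap) (x : Nat)
    (h1 : inv_hmap m) (h2 : succd m Dim.zero x) :
    planar m ↔
      planar (B m Dim.zero x) ∧
        (¬ eqc (B m Dim.zero x) x (A m Dim.zero x) ∨
          expf (B m Dim.zero x) (cA_1 (B m Dim.zero x) Dim.one x) (A m Dim.zero x)) := by
  obtain ⟨hi, hs⟩ := B_sim x h1 h2
  have hg := hs.genus h1 hi
  have hc := face_comp0 hi
  have hp := genus_nonneg hi.1
  unfold planar
  rw [hg]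
  generalize B m Dim.zero x = M at *
  generalize A m Dim.zero x = y at *
  simp only [genus, nc, ec, nv, ne, nf, nd] at *
  by_cases h1 : eqc M x y <;> by_cases h2 : expf M (cA_1 M Dim.one x) y <;>
    simp only [h1, h2, if_true, if_false, not_true, not_false_eq_true, or_true, or_false,
      and_true, and_false, iff_false] at * <;> first | omega | tauto
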